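/- Vanishing of the reduced type-D coefficient determinant: with ρ_i^{(m)} (0 ≤ i, m ≤ L) defined by ρ_0^{(m)} := (c(x_m−x₀)/b(x_m−x₀))·∏_{k=1}^L b(x₀−μ_k)·∏_{k=1, k≠m}^L (a(x₀−x_k)/b(x₀−x_k)) for m ≠ 0; ρ_m^{(m)} := ∏_{k=1}^L a(x_m−μ_k) − ∏_{k=1}^L b(x_m−μ_k)·∏_{k=0, k≠m}^L (a(x_m−x_k)/b(x_m−x_k)); and otherwise ρ_i^{(m)} := (c(x_m−x_i)/b(x_m−x_i))·∏_{k=1}^L b(x_i−μ_k)·∏_{k=0, k≠i,m}^L (a(x_i−x_k)/b(x_i−x_k)), one has det((ρ_i^{(m)})_{0≤i,m≤L}) = 0. -/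

import Mathlib

open scoped BigOperators Matrix

/-- The six-vertex weight `a(x) = sinh(x+γ)`. -/
noncomputable def av (γ x : ℂ) : ℂ := Complex.sinh (x + γ)

/-- The six-vertex weight `b(x) = sinh(x)`. -/
noncomputable def bv (x : ℂ) : ℂ := Complex.sinh x

/-- The six-vertex weight `c(x) = sinh(γ)`. -/
noncomputable def cv (γ : ℂ) : ℂ := Complex.sinh γ

/-- The vector `(x₀, x₁, …, x_L)` of all `L+1` variables. -/
noncomputable def consv {L : ℕ} (x₀ : ℂ) (x : Fin L → ℂ) : Fin (L + 1) → ℂ :=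
  Fin.cons x₀ x

/-- The coefficients `ρ_i^{(m)}` (`0 ≤ i, m ≤ L`) of the reduced type-D system, as
functions of the full variable vector `y = (x₀, x₁, …, x_L)`. -/
noncomputable def rho6 (γ : ℂ) {L : ℕ} (μ : Fin L → ℂ) (y : Fin (L + 1) → ℂ)
    (m i : Fin (L + 1)) : ℂ :=
  if i = m then
    (∏ k, av γ (y m - μ k)) -
      (∏ k, bv (y m - μ k)) *
        ∏ k ∈ Finset.univ.erase m, av γ (y m - y k) / bv (y m - y k)
  else if i = 0 then
    cv γ / bv (y m - y 0) * (∏ k, bv (y 0 - μ k)) *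
      ∏ k ∈ Finset.univ.filter (fun k : Fin L => (k.succ : Fin (L + 1)) ≠ m),
        av γ (y 0 - y k.succ) / bv (y 0 - y k.succ)
  else
    cv γ / bv (y m - y i) * (∏ k, bv (y i - μ k)) *
      ∏ k ∈ (Finset.univ.erase i).erase m, av γ (y i - y k) / bv (y i - y k)

theorem Complex.sinh_sub_eq_exp_mul (z w : ℂ) :
    Complex.sinh (z - w) =
      Complex.exp (-z) * (Complex.exp (-w) / 2) *
        (Complex.exp (2 * z) - Complex.exp (2 * w)) := by
  have hz : Complex.exp (2 * z) = Complex.exp z * Complex.exp z := by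
    rw [← Complex.exp_add, two_mul]
  have hw : Complex.exp (2 * w) = Complex.exp w * Complex.exp w := by
    rw [← Complex.exp_add, two_mul]
  have hz0 := Complex.exp_ne_zero z
  have hw0 := Complex.exp_ne_zero w
  rw [Complex.sinh, neg_sub, Complex.exp_sub, Complex.exp_sub, hz, hw, Complex.exp_neg,
    Complex.exp_neg]
  field_simp

theorem Complex.sinh_sub_div_sinh_sub (z w v : ℂ) :
    Complex.sinh (z - v) / Complex.sinh (w - v) =
      Complex.exp (w - z) * ((Complex.exp (2 * w) - Complex.exp (2 * v))⁻¹ *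
        (Complex.exp (2 * z) - Complex.exp (2 * v))) := by
  have hv0 := Complex.exp_ne_zero v
  have hw0 := Complex.exp_ne_zero w
  have hz0 := Complex.exp_ne_zero z
  rw [Complex.sinh_sub_eq_exp_mul, Complex.sinh_sub_eq_exp_mul, Complex.exp_sub, Complex.exp_neg,
    Complex.exp_neg, Complex.exp_neg, div_eq_mul_inv, mul_inv]
  field_simp

/-- Hyperbolic Lagrange interpolation: a product of `n` shifted `sinh` factors is determined
by its values at `n + 1` nodes. -/
theorem Complex.prod_sinh_sub_eq_sum_lagrange {ι κ : Type*} [DecidableEq ι]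
    (s : Finset ι) (t : Finset κ) (hcard : s.card = t.card + 1) (y : ι → ℂ) (μ : κ → ℂ)
    (hs : ∀ i ∈ s, ∀ j ∈ s, i ≠ j → Complex.sinh (y i - y j) ≠ 0) (z : ℂ) :
    ∏ k ∈ t, Complex.sinh (z - μ k) =
      ∑ m ∈ s, (∏ k ∈ t, Complex.sinh (y m - μ k)) *
        ∏ k ∈ s.erase m, Complex.sinh (z - y k) / Complex.sinh (y m - y k) := by
  set P : Polynomial ℂ :=
    ∏ k ∈ t, (Polynomial.X - Polynomial.C (Complex.exp (2 * μ k))) with hP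
  have hnodes : Set.InjOn (fun i => Complex.exp (2 * y i)) s := by
    intro i hi j hj hij
    by_contra hne
    apply hs i hi j hj hne
    rw [Complex.sinh_sub_eq_exp_mul, sub_eq_zero.mpr hij, mul_zero]
  have hdeg : P.degree < s.card := by
    rw [hP, Polynomial.degree_prod, Finset.sum_congr rfl fun k _ => Polynomial.degree_X_sub_C _,
      hcard]
    simp only [Finset.sum_const, nsmul_eq_mul, mul_one]
    exact_mod_cast Nat.lt_succ_self _
  have hprod (u : ℂ) : ∏ k ∈ t, Complex.sinh (u - μ k) =
      Complex.exp (-u) ^ t.card * (∏ k ∈ t, Complex.exp (-μ k) / 2) *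
        P.eval (Complex.exp (2 * u)) := by
    simp only [Complex.sinh_sub_eq_exp_mul, Finset.prod_mul_distrib, Finset.prod_const, hP,
      Polynomial.eval_prod, Polynomial.eval_sub, Polynomial.eval_X, Polynomial.eval_C]
  have hinterp := congrArg (Polynomial.eval (Complex.exp (2 * z)))
    (Lagrange.eq_interpolate hnodes hdeg)
  simp only [Lagrange.interpolate_apply, Polynomial.eval_finsetSum, Polynomial.eval_mul,
    Polynomial.eval_C, Lagrange.basis, Polynomial.eval_prod, Lagrange.basisDivisor,
    Polynomial.eval_sub, Polynomial.eval_X] at hinterp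
  rw [hprod, hinterp, Finset.mul_sum]
  refine Finset.sum_congr rfl fun m hm => ?_
  rw [hprod]
  simp only [Complex.sinh_sub_div_sinh_sub]
  rw [Finset.prod_mul_distrib (f := fun _ => Complex.exp (y m - z)), Finset.prod_const,
    Finset.card_erase_of_mem hm, hcard, Nat.add_sub_cancel]
  have hexp : Complex.exp (-z) ^ t.card =
      Complex.exp (-y m) ^ t.card * Complex.exp (y m - z) ^ t.card := by
    rw [← mul_pow, ← Complex.exp_add]
    ring_nf
  rw [hexp]
  ring

theorem rho6_self (γ : ℂ) {L : ℕ} (μ : Fin L → ℂ) (y : Fin (L + 1) → ℂ) (i : Fin (L + 1)) :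
    rho6 γ μ y i i =
      (∏ k, av γ (y i - μ k)) -
        (∏ k, bv (y i - μ k)) * ∏ k ∈ Finset.univ.erase i, av γ (y i - y k) / bv (y i - y k) :=
  if_pos rfl

theorem rho6_of_ne (γ : ℂ) {L : ℕ} (μ : Fin L → ℂ) (y : Fin (L + 1) → ℂ) {m i : Fin (L + 1)}
    (h : i ≠ m) :
    rho6 γ μ y m i =
      cv γ / bv (y m - y i) * (∏ k, bv (y i - μ k)) *
        ∏ k ∈ (Finset.univ.erase i).erase m, av γ (y i - y k) / bv (y i - y k) := by
  rw [rho6, if_neg h]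
  split_ifs with h0
  · subst h0
    congr 1
    refine Finset.prod_nbij Fin.succ ?_ (Fin.succ_injective L).injOn ?_ fun _ _ => rfl
    · intro k hk
      simpa [Fin.succ_ne_zero] using hk
    · intro k hk
      obtain ⟨hk0, hkm⟩ : k ≠ 0 ∧ k ≠ m := by simpa using hk
      obtain ⟨j, rfl⟩ := Fin.exists_succ_eq.mpr hk0
      exact ⟨j, by simpa using hkm, rfl⟩
  · rfl

/-- The Lagrange weights of `∏ k, b(· - μ k)` lie in the kernel of the matrix `rho6`. -/
theorem sum_rho6_mul_lagrange_weight (γ : ℂ) {L : ℕ} (μ : Fin L → ℂ) (y : Fin (L + 1) → ℂ)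
    (hs : ∀ k l : Fin (L + 1), k ≠ l → Complex.sinh (y k - y l) ≠ 0) (i : Fin (L + 1)) :
    ∑ m, rho6 γ μ y m i *
      ((∏ k, bv (y m - μ k)) / ∏ k ∈ Finset.univ.erase m, bv (y m - y k)) = 0 := by
  have hinterp := Complex.prod_sinh_sub_eq_sum_lagrange Finset.univ Finset.univ (by simp) y μ
    (fun i _ j _ => hs i j) (y i + γ)
  have hshift (w : ℂ) : Complex.sinh (y i + γ - w) = av γ (y i - w) := by
    rw [av]
    ring_nf
  simp only [hshift, Finset.prod_div_distrib] at hinterp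
  have hden : ∏ k ∈ Finset.univ.erase i, bv (y i - y k) ≠ 0 :=
    Finset.prod_ne_zero_iff.mpr fun k hk => hs i k (Finset.ne_of_mem_erase hk).symm
  rw [← Finset.add_sum_erase _ _ (Finset.mem_univ i)] at hinterp ⊢
  have hoff : ∀ m ∈ Finset.univ.erase i, rho6 γ μ y m i *
      ((∏ k, bv (y m - μ k)) / ∏ k ∈ Finset.univ.erase m, bv (y m - y k)) =
      -((∏ k, bv (y i - μ k)) / ∏ k ∈ Finset.univ.erase i, bv (y i - y k)) *
        ((∏ k, Complex.sinh (y m - μ k)) *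
          ((∏ k ∈ Finset.univ.erase m, av γ (y i - y k)) /
            ∏ k ∈ Finset.univ.erase m, Complex.sinh (y m - y k))) := by
    intro m hm
    have hmi : m ≠ i := Finset.ne_of_mem_erase hm
    have hmi0 : bv (y m - y i) ≠ 0 := hs m i hmi
    have hneg : bv (y i - y m) = -bv (y m - y i) := by
      rw [bv, bv, ← Complex.sinh_neg, neg_sub]
    have hself : av γ (y i - y i) = cv γ := by simp [av, cv]
    have hrest : ∏ k ∈ (Finset.univ.erase i).erase m, bv (y i - y k) ≠ 0 :=
      Finset.prod_ne_zero_iff.mpr fun k hk =>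
        hs i k (Finset.ne_of_mem_erase (Finset.mem_of_mem_erase hk)).symm
    have hdenm : ∏ k ∈ Finset.univ.erase m, bv (y m - y k) ≠ 0 :=
      Finset.prod_ne_zero_iff.mpr fun k hk => hs m k (Finset.ne_of_mem_erase hk).symm
    change _ = _ * ((∏ k, bv (y m - μ k)) * (_ / ∏ k ∈ Finset.univ.erase m, bv (y m - y k)))
    rw [rho6_of_ne γ μ y hmi.symm, Finset.prod_div_distrib,
      ← Finset.mul_prod_erase (Finset.univ.erase i) (fun k => bv (y i - y k)) hm,
      ← Finset.mul_prod_erase (Finset.univ.erase m) (fun k => av γ (y i - y k))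
        (Finset.mem_erase.mpr ⟨hmi.symm, Finset.mem_univ i⟩),
      Finset.erase_right_comm (a := m) (b := i), hself, hneg]
    field_simp
  rw [Finset.sum_congr rfl hoff, ← Finset.mul_sum, rho6_self, hinterp, Finset.prod_div_distrib]
  change (_ + _ - _) * _ + -_ * _ = (0 : ℂ)
  simp only [bv]
  ring

theorem exists_prod_bv_ne_zero {L : ℕ} (μ : Fin L → ℂ) (y : Fin (L + 1) → ℂ)
    (hs : ∀ k l : Fin (L + 1), k ≠ l → Complex.sinh (y k - y l) ≠ 0) :
    ∃ m, ∏ k, bv (y m - μ k) ≠ 0 := by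
  by_contra! h
  simp only [Finset.prod_eq_zero_iff, Finset.mem_univ, true_and] at h
  choose f hf using h
  obtain ⟨i, j, hij, hfij⟩ := Fintype.exists_ne_map_eq_of_card_lt f (by simp)
  have hi : Complex.sinh (y i - μ (f i)) = 0 := hf i
  have hj : Complex.sinh (y j - μ (f i)) = 0 := hfij ▸ hf j
  apply hs i j hij
  rw [← sub_sub_sub_cancel_right (y i) (y j) (μ (f i)), Complex.sinh_sub, hi, hj]
  ring

/-- Vanishing of the reduced type-D coefficient determinant:
`det((ρ_i^{(m)})_{0≤i,m≤L}) = 0`. -/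
theorem reduced_typeD_det_vanishes (γ : ℂ) (L : ℕ) (hL : 1 ≤ L) (μ : Fin L → ℂ)
    (x₀ : ℂ) (x : Fin L → ℂ)
    (hs : ∀ k l : Fin (L + 1), k ≠ l →
      Complex.sinh (consv x₀ x k - consv x₀ x l) ≠ 0) :
    Matrix.det (Matrix.of fun i m : Fin (L + 1) => rho6 γ μ (consv x₀ x) m i) = 0 := by
  obtain ⟨m, hm⟩ := exists_prod_bv_ne_zero μ (consv x₀ x) hs
  refine Matrix.exists_mulVec_eq_zero_iff.mp
    ⟨fun m => (∏ k, bv (consv x₀ x m - μ k)) /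
      ∏ k ∈ Finset.univ.erase m, bv (consv x₀ x m - consv x₀ x k), ?_, ?_⟩
  · intro h
    exact div_ne_zero hm
      (Finset.prod_ne_zero_iff.mpr fun k hk => hs m k (Finset.ne_of_mem_erase hk).symm)
      (congrFun h m)
  · ext i
    exact sum_rho6_mul_lagrange_weight γ μ (consv x₀ x) hs i
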